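/- arXiv:1511.08585 — 6 statements merged into one kernel-verified Lean document; each statement's English description precedes it below -/
import Mathlib

section
/- Let Γ ≥ 0, let T ≥ 1 be a natural number, and let C : ℝ → ℝ be convex and nondecreasing on the interval [0, Γ]. Let A be a nonempty set, g : A → ℝ, and x : A → (Fin T → ℝ) with x(a)_t ∈ [0, Γ] for every a ∈ A and t. Then the infimum over a ∈ A of g(a) + C((1/T)·Σ_t x(a)_t) equals the infimum over all pairs (a, γ) with a ∈ A, γ : Fin T → ℝ, γ_t ∈ [0, Γ] for all t, and (1/T)·Σ_t γ_t = (1/T)·Σ_t x(a)_t, of g(a) + (1/T)·Σ_t C(γ_t). -/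
/-- Equivalence of problems P2 and P3 (Appendix A), stated abstractly:
replacing the convex cost of the time average by the time average of the costs of
an auxiliary sequence with the same range and the same time average does not
change the optimal value. -/
theorem stmt_4 (Γ : ℝ) (hΓ : 0 ≤ Γ) (T : ℕ) (hT : 1 ≤ T)
    (C : ℝ → ℝ)
    (hconv : ConvexOn ℝ (Set.Icc 0 Γ) C)
    (hmono : MonotoneOn C (Set.Icc 0 Γ))
    {A : Type*} [Nonempty A] (g : A → ℝ) (x : A → Fin T → ℝ)
    (hx : ∀ a t, x a t ∈ Set.Icc (0 : ℝ) Γ) :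
    sInf {v : ℝ | ∃ a : A, v = g a + C ((1 / (T : ℝ)) * ∑ t, x a t)} =
    sInf {v : ℝ | ∃ (a : A) (γ : Fin T → ℝ),
      (∀ t, γ t ∈ Set.Icc (0 : ℝ) Γ) ∧
      (1 / (T : ℝ)) * ∑ t, γ t = (1 / (T : ℝ)) * ∑ t, x a t ∧
      v = g a + (1 / (T : ℝ)) * ∑ t, C (γ t)} := by
  have hT0 : (T : ℝ) ≠ 0 := by positivity
  have jensen : ∀ γ : Fin T → ℝ, (∀ t, γ t ∈ Set.Icc (0 : ℝ) Γ) →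
      C ((1 / (T : ℝ)) * ∑ t, γ t) ≤ (1 / (T : ℝ)) * ∑ t, C (γ t) := by
    intro γ hγ
    have h := hconv.map_sum_le (t := Finset.univ) (w := fun _ : Fin T => 1 / (T : ℝ)) (p := γ)
      (fun _ _ => by positivity) (by simp [hT0]) (fun t _ => hγ t)
    simpa only [smul_eq_mul, ← Finset.mul_sum] using h
  have mem : ∀ a, (1 / (T : ℝ)) * ∑ t, x a t ∈ Set.Icc (0 : ℝ) Γ := by
    intro a
    have h := hconv.1.sum_mem (t := Finset.univ) (w := fun _ : Fin T => 1 / (T : ℝ)) (z := x a)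
      (fun _ _ => by positivity) (by simp [hT0]) (fun t _ => hx a t)
    simpa only [smul_eq_mul, ← Finset.mul_sum] using h
  apply csInf_eq_csInf_of_forall_exists_le
  · rintro _ ⟨a, rfl⟩
    refine ⟨_, ⟨a, fun _ => (1 / (T : ℝ)) * ∑ t, x a t, fun _ => mem a, ?_, rfl⟩, ?_⟩
    · simp [hT0]
    · simp [hT0]
  · rintro _ ⟨a, γ, hγ, havg, rfl⟩
    refine ⟨_, ⟨a, rfl⟩, ?_⟩
    rw [← havg]
    gcongr
    exact jensen γ hγ
end

section
/- Let μ > 0, Rmax ≥ 0, Dmax ≥ 0, dtmax ≥ 0, dmax ≥ 0, Δ̂ be real numbers (Δ̂ denotes Δ_u/T_o). Let E, Q, D, Sr, Sw, Ld, xu, γu, d, γd be real numbers satisfying: E ≥ 0, Sr ≥ 0, Q ≥ 0, 0 ≤ Q + Sr ≤ Rmax, 0 ≤ D ≤ Dmax, E − Q + Sw + D = Ld, 0 ≤ Sw ≤ Ld, xu = |Q + Sr − D|, 0 ≤ γu ≤ max(Rmax, Dmax), 0 ≤ d ≤ dtmax, and 0 ≤ γd ≤ min(dtmax, dmax). Let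 Z, Hu, X, Hd be real numbers with X ≥ 0, and define the updated queues Z' = Z + Q + Sr − D − Δ̂, Hu' = Hu + γu − xu, X' = max(X + d − dmax, 0), Hd' = Hd + γd − d. Define L(Z, Hu, X, Hd) = (1/2)·(Z² + Hu² + μ·(X² + Hd²)). Then L(Z', Hu', X', Hd') − L(Z, Hu, X, Hd) ≤ Z·(E + Sr + Sw − Ld − Δ̂) + Hu·γu − Hu·(E + Sr) − |Hu|·(Sw − Ld) + μ·X·(d − dmax) + μ·Hd·(γd − d) + G, where G = (1/2)·max((Rmax − Δ̂)², (Dmax + Δ̂)²) + (1/2)·max(Rmax², Dmax²) + (μ/2)·max(dmax², (dtmax − dmax)²) + (μ/2)·dtmax². -/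
/-- The square of a point of `[a, b]` is at most the larger of the squares of the endpoints. -/
theorem sq_le_max_sq_of_mem_Icc {a b x : ℝ} (ha : a ≤ x) (hb : x ≤ b) :
    x ^ 2 ≤ max (a ^ 2) (b ^ 2) := by
  rcases le_total 0 x with h | h
  · exact le_max_of_le_right (by nlinarith)
  · exact le_max_of_le_left (by nlinarith)

/-- Replacing `|a - l|` by `a` and `l` in a product with a term of arbitrary sign. -/
theorem neg_mul_abs_sub_le {a l : ℝ} (ha : 0 ≤ a) (hl : 0 ≤ l) (h : ℝ) :
    -h * |a - l| ≤ -h * a + |h| * l := by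
  rcases le_total 0 h with hh | hh
  · rw [abs_of_nonneg hh]
    nlinarith [le_abs_self (a - l)]
  · rw [abs_of_nonpos hh]
    have : |a - l| ≤ a + l := abs_le.2 ⟨by linarith, by linarith⟩
    nlinarith

/-- Lemma 2: one-slot Lyapunov drift bound for the four virtual queues of the
energy storage management system. -/
theorem stmt_7 (μ Rmax Dmax dtmax dmax Δhat : ℝ)
    (hμ : 0 < μ) (hR : 0 ≤ Rmax) (hD : 0 ≤ Dmax) (hdt : 0 ≤ dtmax) (hdm : 0 ≤ dmax)
    (E Q D Sr Sw Ld xu γu d γd : ℝ)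
    (hE : 0 ≤ E) (hSr : 0 ≤ Sr) (hQ : 0 ≤ Q)
    (hQSr : 0 ≤ Q + Sr) (hQSr' : Q + Sr ≤ Rmax)
    (hD0 : 0 ≤ D) (hD1 : D ≤ Dmax)
    (hbal : E - Q + Sw + D = Ld)
    (hSw0 : 0 ≤ Sw) (hSw1 : Sw ≤ Ld)
    (hxu : xu = |Q + Sr - D|)
    (hγu0 : 0 ≤ γu) (hγu1 : γu ≤ max Rmax Dmax)
    (hd0 : 0 ≤ d) (hd1 : d ≤ dtmax)
    (hγd0 : 0 ≤ γd) (hγd1 : γd ≤ min dtmax dmax)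
    (Z Hu X Hd : ℝ) (hX : 0 ≤ X)
    (Z' Hu' X' Hd' : ℝ)
    (hZ' : Z' = Z + Q + Sr - D - Δhat)
    (hHu' : Hu' = Hu + γu - xu)
    (hX' : X' = max (X + d - dmax) 0)
    (hHd' : Hd' = Hd + γd - d)
    (L : ℝ → ℝ → ℝ → ℝ → ℝ)
    (hL : ∀ z hu x hd, L z hu x hd = (1 / 2) * (z ^ 2 + hu ^ 2 + μ * (x ^ 2 + hd ^ 2)))
    (G : ℝ)
    (hG : G = (1 / 2) * max ((Rmax - Δhat) ^ 2) ((Dmax + Δhat) ^ 2)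
        + (1 / 2) * max (Rmax ^ 2) (Dmax ^ 2)
        + (μ / 2) * max (dmax ^ 2) ((dtmax - dmax) ^ 2)
        + (μ / 2) * dtmax ^ 2) :
    L Z' Hu' X' Hd' - L Z Hu X Hd ≤
      Z * (E + Sr + Sw - Ld - Δhat) + Hu * γu - Hu * (E + Sr)
        - |Hu| * (Sw - Ld) + μ * X * (d - dmax) + μ * Hd * (γd - d) + G := by
  have hb : Q + Sr - D = (E + Sr) - (Ld - Sw) := by linarith
  have hZ : (Q + Sr - D - Δhat) ^ 2 ≤ max ((Rmax - Δhat) ^ 2) ((Dmax + Δhat) ^ 2) := by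
    have h := sq_le_max_sq_of_mem_Icc (a := -(Dmax + Δhat)) (b := Rmax - Δhat)
      (x := Q + Sr - D - Δhat) (by linarith) (by linarith)
    rwa [neg_sq, max_comm] at h
  have hx0 : 0 ≤ xu := hxu ▸ abs_nonneg _
  have hx1 : xu ≤ max Rmax Dmax := by
    rw [hxu, abs_le]
    constructor <;> linarith [le_max_left Rmax Dmax, le_max_right Rmax Dmax]
  have hH : (γu - xu) ^ 2 ≤ max (Rmax ^ 2) (Dmax ^ 2) := by
    have h : (γu - xu) ^ 2 ≤ (max Rmax Dmax) ^ 2 :=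
      sq_le_sq' (by linarith) (by linarith)
    rcases max_choice Rmax Dmax with hm | hm <;> rw [hm] at h
    · exact le_max_of_le_left h
    · exact le_max_of_le_right h
  have hcross : -Hu * xu ≤ -Hu * (E + Sr) + |Hu| * (Ld - Sw) := by
    rw [hxu, hb]
    exact neg_mul_abs_sub_le (by linarith) (by linarith) Hu
  have hXd : (d - dmax) ^ 2 ≤ max (dmax ^ 2) ((dtmax - dmax) ^ 2) := by
    have h := sq_le_max_sq_of_mem_Icc (a := -dmax) (b := dtmax - dmax)
      (x := d - dmax) (by linarith) (by linarith)
    rwa [neg_sq] at h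
  have hXsq : X' ^ 2 ≤ (X + d - dmax) ^ 2 := by
    rw [hX']
    rcases max_choice (X + d - dmax) 0 with hm | hm <;> rw [hm]
    nlinarith [sq_nonneg (X + d - dmax)]
  have hHd : (γd - d) ^ 2 ≤ dtmax ^ 2 :=
    sq_le_sq' (by linarith) (by linarith [min_le_left dtmax dmax])
  have hdelay : μ * (X' ^ 2 + (γd - d) ^ 2) ≤
      μ * (X ^ 2 + 2 * X * (d - dmax) + max (dmax ^ 2) ((dtmax - dmax) ^ 2) + dtmax ^ 2) :=
    mul_le_mul_of_nonneg_left (by linarith) hμ.le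
  have hZb : Z' = Z + (Q + Sr - D - Δhat) := by linarith
  have hZc : Z * (E + Sr + Sw - Ld - Δhat) = Z * (Q + Sr - D - Δhat) := by
    rw [hb]; ring
  rw [hL, hL, hG, hZc, hZb, hHu', hHd']
  linarith
end

section
/- Let T ≥ 1 be a natural number, G a real number, μ > 0, and let L : ℕ → ℝ and X : ℕ → ℝ satisfy L_{t+1} − L_t ≤ G for all t < T and (μ/2)·X_T² ≤ L_T. Then the margin ε_d := (X_T − X_0)/T satisfies |ε_d| ≤ √(2·(T·G + L_0)/μ)/T + |X_0|/T. -/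
/-- A sequence whose increments are at most `G` before time `T` grows at most linearly up to `T`. -/
theorem le_mul_add_of_forall_sub_le {T : ℕ} {G : ℝ} {L : ℕ → ℝ}
    (h : ∀ t < T, L (t + 1) - L t ≤ G) : L T ≤ (T : ℝ) * G + L 0 := by
  have hsum := Finset.sum_le_card_nsmul (Finset.range T) (fun t => L (t + 1) - L t) G
    fun t ht => h t (Finset.mem_range.mp ht)
  rw [Finset.sum_range_sub, Finset.card_range, nsmul_eq_mul] at hsum
  linarith

/-- Proposition 4: bound on the margin of the average-delay constraint. -/
theorem stmt_13 (T : ℕ) (hT : 1 ≤ T) (G μ : ℝ) (hμ : 0 < μ) (L X : ℕ → ℝ)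
    (hdrift : ∀ t < T, L (t + 1) - L t ≤ G)
    (hquad : (μ / 2) * (X T) ^ 2 ≤ L T) :
    |(X T - X 0) / T| ≤ Real.sqrt (2 * ((T : ℝ) * G + L 0) / μ) / T + |X 0| / T := by
  have hX : |X T| ≤ Real.sqrt (2 * ((T : ℝ) * G + L 0) / μ) := by
    apply Real.abs_le_sqrt
    rw [le_div_iff₀ hμ]
    linarith [le_mul_add_of_forall_sub_le hdrift]
  rw [abs_div, Nat.abs_cast, ← add_div]
  gcongr
  exact (abs_sub _ _).trans (by gcongr)
end

section
/- Let cE ≤ 0 and cS ≤ cE be real numbers, and let Emax ≥ 0, Rmax ≥ 0, Sav ≥ 0, and Ln be real numbers with 0 ≤ Ln ≤ Emax. Consider minimizing cE·E + cS·Sr over real variables (E, Q, Sr) subject to 0 ≤ E ≤ Emax, Q ≥ 0, 0 ≤ Sr ≤ Sav, Q + Sr ≤ Rmax, and E − Q = Ln. Then the point Sr* = min(Sav, Rmax), Q* = min(Rmax − Sr*, Emax − Ln), E* = Ln + Q* is feasible and minimizes the objective over the feasible set. -/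
/-- Closed-form solution of the charging-state subproblem in Case i) of the
energy control problem P4_b2. -/
theorem stmt_15 (cE cS Emax Rmax Sav Ln : ℝ)
    (hcE : cE ≤ 0) (hcS : cS ≤ cE)
    (hEmax : 0 ≤ Emax) (hRmax : 0 ≤ Rmax) (hSav : 0 ≤ Sav)
    (hLn0 : 0 ≤ Ln) (hLn1 : Ln ≤ Emax) :
    (0 ≤ Ln + min (Rmax - min Sav Rmax) (Emax - Ln) ∧
      Ln + min (Rmax - min Sav Rmax) (Emax - Ln) ≤ Emax ∧
      0 ≤ min (Rmax - min Sav Rmax) (Emax - Ln) ∧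
      0 ≤ min Sav Rmax ∧ min Sav Rmax ≤ Sav ∧
      min (Rmax - min Sav Rmax) (Emax - Ln) + min Sav Rmax ≤ Rmax ∧
      (Ln + min (Rmax - min Sav Rmax) (Emax - Ln))
        - min (Rmax - min Sav Rmax) (Emax - Ln) = Ln) ∧
    ∀ E Q Sr : ℝ,
      0 ≤ E → E ≤ Emax → 0 ≤ Q → 0 ≤ Sr → Sr ≤ Sav → Q + Sr ≤ Rmax → E - Q = Ln →
      cE * (Ln + min (Rmax - min Sav Rmax) (Emax - Ln)) + cS * min Sav Rmax
        ≤ cE * E + cS * Sr := by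
  have hsS : min Sav Rmax ≤ Sav := min_le_left _ _
  have hsR : min Sav Rmax ≤ Rmax := min_le_right _ _
  have hs0 : 0 ≤ min Sav Rmax := le_min hSav hRmax
  have hs (x : ℝ) (h₁ : x ≤ Sav) (h₂ : x ≤ Rmax) : x ≤ min Sav Rmax := le_min h₁ h₂
  generalize min Sav Rmax = s at *
  have hqR : min (Rmax - s) (Emax - Ln) ≤ Rmax - s := min_le_left _ _
  have hqE : min (Rmax - s) (Emax - Ln) ≤ Emax - Ln := min_le_right _ _
  have hq0 : 0 ≤ min (Rmax - s) (Emax - Ln) := le_min (by linarith) (by linarith)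
  have hq (x : ℝ) (h₁ : x ≤ Rmax - s) (h₂ : x ≤ Emax - Ln) :
      x ≤ min (Rmax - s) (Emax - Ln) := le_min h₁ h₂
  generalize min (Rmax - s) (Emax - Ln) = q at *
  refine ⟨⟨by linarith, by linarith, hq0, hs0, hsS, by linarith, by ring⟩, ?_⟩
  intro E Q Sr _ hE hQ _ hSr hR hbal
  have hSrs : Sr ≤ s := hs Sr hSr (by linarith)
  have htotal : Q + Sr ≤ q + s := by
    linarith [hq (Q + Sr - s) (by linarith) (by linarith)]
  obtain rfl : E = Ln + Q := by linarith
  linarith [mul_le_mul_of_nonpos_left htotal hcE,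
    mul_le_mul_of_nonpos_left hSrs (sub_nonpos.mpr hcS)]
end

section
/- Let Γ > 0 and K ≥ 0 be real numbers, and let H : ℕ → ℝ, γ : ℕ → ℝ, x : ℕ → ℝ satisfy for all t: H_{t+1} = H_t + γ_t − x_t, 0 ≤ x_t ≤ Γ, 0 ≤ γ_t ≤ Γ, γ_t = 0 whenever H_t ≥ 0, and γ_t = Γ whenever H_t < −K. Then for all t: min(H_0, −K − Γ) ≤ H_t ≤ max(H_0, Γ). -/
/-- Boundedness of the battery-usage virtual queue under the proposed algorithm's
auxiliary-variable decision. -/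
theorem stmt_16 (Γ K : ℝ) (hΓ : 0 < Γ) (hK : 0 ≤ K)
    (H γ x : ℕ → ℝ)
    (hrec : ∀ t, H (t + 1) = H t + γ t - x t)
    (hx : ∀ t, 0 ≤ x t ∧ x t ≤ Γ)
    (hγ : ∀ t, 0 ≤ γ t ∧ γ t ≤ Γ)
    (hγ0 : ∀ t, 0 ≤ H t → γ t = 0)
    (hγΓ : ∀ t, H t < -K → γ t = Γ) :
    ∀ t, min (H 0) (-K - Γ) ≤ H t ∧ H t ≤ max (H 0) Γ := by
  intro t
  induction t with
  | zero => exact ⟨min_le_left _ _, le_max_left _ _⟩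
  | succ t ih =>
    obtain ⟨hl, hu⟩ := ih
    obtain ⟨hx0, hx1⟩ := hx t
    obtain ⟨hg0, hg1⟩ := hγ t
    rw [hrec t]
    constructor
    · rcases lt_or_ge (H t) (-K) with h | h
      · linarith [hγΓ t h]
      · exact (min_le_right _ _).trans (by linarith)
    · rcases lt_or_ge (H t) 0 with h | h
      · exact le_trans (by linarith) (le_max_right _ _)
      · linarith [hγ0 t h]
end

section
/- Let M ≥ 1 and T ≥ 1 be natural numbers and T₀ = M·T. Let α > 0, V > 0, G be real numbers, Γu > 0, Γd > 0, and let Cu, Cd : ℝ → ℝ be convex, differentiable, and nondecreasing on [0, Γu] and [0, Γd] respectively, with derivatives Cu' and Cd'. Let e, xe, γu, xu, γd, d : ℕ → ℝ be sequences with γu_t, xu_t ∈ [0, Γu] and γd_t, d_t ∈ [0, Γd] for all t < T₀, and let Hu, Hd : ℕ → ℝ satisfy Hu_{t+1} = Hu_t + γu_t − xu_t and Hd_{t+1} = Hd_t + γd_t − d_t for all t < T₀. Define the per-slot cost c_t = e_t + xe_t + Cu(γu_t) + α·Cd(γd_t), and let L : ℕ → ℝ and u : {0, …, M−1} → ℝ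 satisfy, for every m < M: L((m+1)·T) − L(m·T) + V·Σ_{t=mT}^{(m+1)T−1} c_t ≤ G·T² + V·T·u_m. Let x̄u = (1/T₀)·Σ_{t<T₀} xu_t and d̄ = (1/T₀)·Σ_{t<T₀} d_t. Then: (1/T₀)·Σ_{t<T₀} e_t + (1/T₀)·Σ_{t<T₀} xe_t + Cu(x̄u) + α·Cd(d̄) − (1/M)·Σ_{m<M} u_m ≤ G·T/V + (L(0) − L(T₀))/(V·T₀) + [Cu'(Γu)·max(Hu_0 − Hu_{T₀}, 0) + α·Cd'(Γd)·max(Hd_0 − Hd_{T₀}, 0)]/T₀. -/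
/-- A convex nondecreasing function on `[0, Γ]` increases at rate at most its derivative at `Γ`. -/
theorem ConvexOn.sub_le_deriv_right_mul_max {f : ℝ → ℝ} {Γ f' a b : ℝ}
    (hconv : ConvexOn ℝ (Set.Icc 0 Γ) f) (hderiv : HasDerivAt f f' Γ)
    (hmono : MonotoneOn f (Set.Icc 0 Γ)) (ha : a ∈ Set.Icc 0 Γ) (hb : b ∈ Set.Icc 0 Γ) :
    f b - f a ≤ f' * max (b - a) 0 := by
  rcases le_or_gt b a with hba | hab
  · rw [max_eq_right (sub_nonpos.2 hba), mul_zero]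
    exact sub_nonpos.2 (hmono hb ha hba)
  · have hΓ : Γ ∈ Set.Icc 0 Γ := ⟨ha.1.trans ha.2, le_rfl⟩
    have hsecant : (f b - f a) / (b - a) ≤ (f Γ - f a) / (Γ - a) :=
      hconv.secant_mono ha hb hΓ hab.ne' (hab.trans_le hb.2).ne' hb.2
    have hslope : slope f a Γ ≤ f' :=
      hconv.slope_le_of_hasDerivAt ha hΓ (hab.trans_le hb.2) hderiv
    rw [slope_def_field] at hslope
    rw [max_eq_left (sub_pos.2 hab).le]
    exact (div_le_iff₀ (sub_pos.2 hab)).1 (hsecant.trans hslope)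

/-- The average of finitely many points of a convex set of reals lies in the set. -/
theorem Convex.average_range_mem {s : Set ℝ} (hs : Convex ℝ s) {n : ℕ} (hn : 0 < n)
    {x : ℕ → ℝ} (hx : ∀ t < n, x t ∈ s) :
    (1 / (n : ℝ)) * ∑ t ∈ Finset.range n, x t ∈ s := by
  have hn' : (n : ℝ) ≠ 0 := by positivity
  have h := hs.sum_mem (t := Finset.range n) (w := fun _ => 1 / (n : ℝ)) (z := x)
    (fun _ _ => by positivity) (by simp [hn']) (fun t ht => hx t (Finset.mem_range.1 ht))
  simpa only [smul_eq_mul, ← Finset.mul_sum] using h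

/-- Jensen's inequality for the average of finitely many points. -/
theorem ConvexOn.map_average_range_le {f : ℝ → ℝ} {s : Set ℝ} (hf : ConvexOn ℝ s f) {n : ℕ}
    (hn : 0 < n) {x : ℕ → ℝ} (hx : ∀ t < n, x t ∈ s) :
    f ((1 / (n : ℝ)) * ∑ t ∈ Finset.range n, x t)
      ≤ (1 / (n : ℝ)) * ∑ t ∈ Finset.range n, f (x t) := by
  have hn' : (n : ℝ) ≠ 0 := by positivity
  have h := hf.map_sum_le (t := Finset.range n) (w := fun _ => 1 / (n : ℝ)) (p := x)
    (fun _ _ => by positivity) (by simp [hn']) (fun t ht => hx t (Finset.mem_range.1 ht))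
  simpa only [smul_eq_mul, ← Finset.mul_sum] using h

/-- The cost of the average of `x` exceeds the average cost of the auxiliary variables `γ` by at
most the derivative of the cost at `Γ` times the average decrease of the virtual queue `H`. -/
theorem ConvexOn.map_average_le_of_queue {f : ℝ → ℝ} {Γ f' : ℝ}
    (hconv : ConvexOn ℝ (Set.Icc 0 Γ) f) (hderiv : HasDerivAt f f' Γ)
    (hmono : MonotoneOn f (Set.Icc 0 Γ)) {n : ℕ} (hn : 0 < n) {γ x H : ℕ → ℝ}
    (hγ : ∀ t < n, γ t ∈ Set.Icc 0 Γ) (hx : ∀ t < n, x t ∈ Set.Icc 0 Γ)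
    (hH : ∀ t < n, H (t + 1) = H t + γ t - x t) :
    f ((1 / (n : ℝ)) * ∑ t ∈ Finset.range n, x t)
      ≤ (1 / (n : ℝ)) * ∑ t ∈ Finset.range n, f (γ t) + f' * max (H 0 - H n) 0 / n := by
  have hsum : ∑ t ∈ Finset.range n, x t - ∑ t ∈ Finset.range n, γ t = H 0 - H n := by
    rw [← Finset.sum_sub_distrib, ← Finset.sum_range_sub']
    refine Finset.sum_congr rfl fun t ht => ?_
    rw [hH t (Finset.mem_range.1 ht)]
    ring
  have hmax : max ((1 / (n : ℝ)) * ∑ t ∈ Finset.range n, x t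
      - (1 / (n : ℝ)) * ∑ t ∈ Finset.range n, γ t) 0 = max (H 0 - H n) 0 / n := by
    rw [← mul_sub, hsum, one_div_mul_eq_div, ← max_div_div_right n.cast_nonneg, zero_div]
  have hgap := hconv.sub_le_deriv_right_mul_max hderiv hmono
    ((convex_Icc 0 Γ).average_range_mem hn hγ) ((convex_Icc 0 Γ).average_range_mem hn hx)
  rw [hmax, ← mul_div_assoc] at hgap
  linarith [hconv.map_average_range_le hn hγ]

/-- Summing drift-plus-cost bounds over consecutive frames of `T` slots. -/
theorem drift_add_cost_le_of_frames {M T : ℕ} {V K : ℝ} {c L u : ℕ → ℝ}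
    (hframe : ∀ m < M,
      L ((m + 1) * T) - L (m * T) + V * ∑ t ∈ Finset.Ico (m * T) ((m + 1) * T), c t
        ≤ K + V * T * u m) :
    L (M * T) - L 0 + V * ∑ t ∈ Finset.range (M * T), c t
      ≤ M * K + V * T * ∑ m ∈ Finset.range M, u m := by
  induction M with
  | zero => simp
  | succ M ih =>
    have hprev := ih fun m hm => hframe m (hm.trans M.lt_succ_self)
    have hlast := hframe M M.lt_succ_self
    have hsplit := Finset.sum_range_add_sum_Ico c (Nat.mul_le_mul_right T M.le_succ)
    rw [Nat.succ_eq_add_one] at hsplit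
    rw [← hsplit, Finset.sum_range_succ]
    push_cast
    linarith

/-- Theorem 1: bounded gap between the `T₀`-slot average system cost achieved by
the real-time algorithm and the average of the optimal `T`-slot look-ahead costs. -/
theorem stmt_17 (M T : ℕ) (hM : 1 ≤ M) (hT : 1 ≤ T)
    (T₀ : ℕ) (hT₀ : T₀ = M * T)
    (α V G : ℝ) (hα : 0 < α) (hV : 0 < V)
    (Γu Γd : ℝ) (hΓu : 0 < Γu) (hΓd : 0 < Γd)
    (Cu Cu' Cd Cd' : ℝ → ℝ)
    (hCuconv : ConvexOn ℝ (Set.Icc 0 Γu) Cu)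
    (hCuderiv : ∀ x ∈ Set.Icc (0 : ℝ) Γu, HasDerivAt Cu (Cu' x) x)
    (hCumono : MonotoneOn Cu (Set.Icc 0 Γu))
    (hCdconv : ConvexOn ℝ (Set.Icc 0 Γd) Cd)
    (hCdderiv : ∀ x ∈ Set.Icc (0 : ℝ) Γd, HasDerivAt Cd (Cd' x) x)
    (hCdmono : MonotoneOn Cd (Set.Icc 0 Γd))
    (e xe γu xu γd d : ℕ → ℝ)
    (hγu : ∀ t < T₀, γu t ∈ Set.Icc (0 : ℝ) Γu)
    (hxu : ∀ t < T₀, xu t ∈ Set.Icc (0 : ℝ) Γu)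
    (hγd : ∀ t < T₀, γd t ∈ Set.Icc (0 : ℝ) Γd)
    (hd : ∀ t < T₀, d t ∈ Set.Icc (0 : ℝ) Γd)
    (Hu Hd : ℕ → ℝ)
    (hHu : ∀ t < T₀, Hu (t + 1) = Hu t + γu t - xu t)
    (hHd : ∀ t < T₀, Hd (t + 1) = Hd t + γd t - d t)
    (c : ℕ → ℝ)
    (hc : ∀ t, c t = e t + xe t + Cu (γu t) + α * Cd (γd t))
    (L u : ℕ → ℝ)
    (hframe : ∀ m < M,
      L ((m + 1) * T) - L (m * T) + V * ∑ t ∈ Finset.Ico (m * T) ((m + 1) * T), c t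
        ≤ G * (T : ℝ) ^ 2 + V * T * u m) :
    (1 / (T₀ : ℝ)) * ∑ t ∈ Finset.range T₀, e t
      + (1 / (T₀ : ℝ)) * ∑ t ∈ Finset.range T₀, xe t
      + Cu ((1 / (T₀ : ℝ)) * ∑ t ∈ Finset.range T₀, xu t)
      + α * Cd ((1 / (T₀ : ℝ)) * ∑ t ∈ Finset.range T₀, d t)
      - (1 / (M : ℝ)) * ∑ m ∈ Finset.range M, u m
    ≤ G * T / V + (L 0 - L T₀) / (V * T₀)
      + (Cu' Γu * max (Hu 0 - Hu T₀) 0 + α * Cd' Γd * max (Hd 0 - Hd T₀) 0) / T₀ := by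
  have hM' : (0 : ℝ) < M := by exact_mod_cast hM
  have hT' : (0 : ℝ) < T := by exact_mod_cast hT
  have hn : 0 < T₀ := hT₀ ▸ Nat.mul_pos hM hT
  have hn' : (0 : ℝ) < T₀ := by exact_mod_cast hn
  have hcast : (T₀ : ℝ) = M * T := by rw [hT₀, Nat.cast_mul]
  have husage := hCuconv.map_average_le_of_queue (hCuderiv Γu ⟨hΓu.le, le_rfl⟩) hCumono hn
    hγu hxu hHu
  have hdelay := mul_le_mul_of_nonneg_left (hCdconv.map_average_le_of_queue
    (hCdderiv Γd ⟨hΓd.le, le_rfl⟩) hCdmono hn hγd hd hHd) hα.le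
  have hdrift := drift_add_cost_le_of_frames hframe
  rw [← hT₀] at hdrift
  have hcost : (1 / (T₀ : ℝ)) * ∑ t ∈ Finset.range T₀, c t
      ≤ G * T / V + (L 0 - L T₀) / (V * T₀) + (1 / (M : ℝ)) * ∑ m ∈ Finset.range M, u m := by
    have hscaled : ∑ t ∈ Finset.range T₀, c t
        ≤ (M * (G * (T : ℝ) ^ 2) + V * T * ∑ m ∈ Finset.range M, u m + (L 0 - L T₀)) / V := by
      rw [le_div_iff₀ hV]
      linarith
    refine (mul_le_mul_of_nonneg_left hscaled (one_div_pos.2 hn').le).trans_eq ?_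
    rw [hcast]
    field_simp
    ring
  have hsum : ∑ t ∈ Finset.range T₀, c t = ∑ t ∈ Finset.range T₀, e t
      + ∑ t ∈ Finset.range T₀, xe t + ∑ t ∈ Finset.range T₀, Cu (γu t)
      + α * ∑ t ∈ Finset.range T₀, Cd (γd t) := by
    simp only [hc, Finset.sum_add_distrib, Finset.mul_sum]
  rw [hsum] at hcost
  rw [add_div, mul_assoc α, mul_div_assoc α]
  linarith
end
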